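/- Let p be a prime, d ≥ 2, 1 ≤ k < d, A = Z_p^k × {0} ⊆ Z_p^d and B = {0} × Z_p^{d−k} ⊆ Z_p^d. Let g : Z_p^d → ℂ with ‖g‖₂ = 1, writing points of Z_p^d as (x₁, x₂) ∈ Z_p^k × Z_p^{d−k}. Then G(g, A, B) is an orthonormal basis of L²(Z_p^d) if and only if both of the following hold: (a) for every x₂ ∈ Z_p^{d−k}, the function m ↦ |Σ_{x₁ ∈ Z_p^k} g(x₁, x₂) χ(−x₁·m)| is constant in m ∈ Z_p^k (the constant may depend on x₂); and (b) the function x₂ ↦ Σ_{x₁ ∈ Z_p^k} |g(x₁, x₂)|² is constant in x₂ ∈ Z_p^{d−k}. -/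

import Mathlib

open Finset

/-- The fixed character `χ(t) = e^{2πi t/p}` of `ℤ/p`. -/
noncomputable def chi (p : ℕ) (t : ZMod p) : ℂ :=
  Complex.exp (2 * Real.pi * Complex.I * (t.val : ℂ) / (p : ℂ))

/-- The dot product on `ℤ_p^d`. -/
def dotp {p d : ℕ} (x y : Fin d → ZMod p) : ZMod p := ∑ i, x i * y i

/-- The Gabor (time-frequency shifted) function `x ↦ g(x-a) χ(x·b)`. -/
noncomputable def gabor {p d : ℕ} (g : (Fin d → ZMod p) → ℂ) (a b : Fin d → ZMod p) :
    (Fin d → ZMod p) → ℂ :=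
  fun x => g (x - a) * chi p (dotp x b)

/-- The inner product of `L²` with counting measure on a finite type. -/
noncomputable def innerC {V : Type*} [Fintype V] (f g : V → ℂ) : ℂ :=
  ∑ x, f x * (starRingEnd ℂ) (g x)

/-- `𝒢(g, A, B)` is an orthonormal basis of `L²(ℤ_p^d)`: the family is orthonormal and
every function is a linear combination of its members. -/
def IsGaborONB {p d : ℕ} [NeZero p] (g : (Fin d → ZMod p) → ℂ)
    (A B : Finset (Fin d → ZMod p)) : Prop :=
  (∀ a ∈ A, ∀ b ∈ B, ∀ a' ∈ A, ∀ b' ∈ B,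
    innerC (gabor g a b) (gabor g a' b') = if a = a' ∧ b = b' then 1 else 0)
  ∧ (∀ f : (Fin d → ZMod p) → ℂ, ∃ c : (Fin d → ZMod p) → (Fin d → ZMod p) → ℂ,
      f = fun x => ∑ a ∈ A, ∑ b ∈ B, c a b * gabor g a b x)

/-- `(E, B)` is a spectral pair: the characters indexed by `B` are pairwise orthogonal in
`L²(E)` and span it. -/
def IsSpectralPair {p d : ℕ} [NeZero p] (E B : Finset (Fin d → ZMod p)) : Prop :=
  (∀ b ∈ B, ∀ b' ∈ B, b ≠ b' → ∑ x ∈ E, chi p (dotp x (b - b')) = 0)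
  ∧ (∀ f : (Fin d → ZMod p) → ℂ, ∃ c : (Fin d → ZMod p) → ℂ,
      ∀ x ∈ E, f x = ∑ b ∈ B, c b * chi p (dotp x b))

/-- `(E, A)` is a tiling pair: `Σ_{a∈A} 1_E(x-a) = 1` for every `x`. -/
def IsTilingPair {p d : ℕ} [NeZero p] (E A : Finset (Fin d → ZMod p)) : Prop :=
  ∀ x : Fin d → ZMod p, (∑ a ∈ A, if x - a ∈ E then (1 : ℕ) else 0) = 1

/-- The Fourier transform `ĝ(m) = p^{-d} Σ_x χ(-x·m) g(x)` on `ℤ_p^d`. -/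
noncomputable def ft {p d : ℕ} [NeZero p] (g : (Fin d → ZMod p) → ℂ)
    (m : Fin d → ZMod p) : ℂ :=
  ((p : ℂ) ^ d)⁻¹ * ∑ x, chi p (-(dotp x m)) * g x

/-- The dot product on `ℤ_p^k × ℤ_p^{d-k} ≅ ℤ_p^d`. -/
def dotp2 {p k m : ℕ} (x y : (Fin k → ZMod p) × (Fin m → ZMod p)) : ZMod p :=
  dotp x.1 y.1 + dotp x.2 y.2

/-- The Gabor function `x ↦ g(x-a) χ(x·b)` on `ℤ_p^k × ℤ_p^{d-k}`. -/
noncomputable def gabor2 {p k m : ℕ} (g : ((Fin k → ZMod p) × (Fin m → ZMod p)) → ℂ)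
    (a b : (Fin k → ZMod p) × (Fin m → ZMod p)) :
    ((Fin k → ZMod p) × (Fin m → ZMod p)) → ℂ :=
  fun x => g (x - a) * chi p (dotp2 x b)

/-- `𝒢(g, A, B)` is an orthonormal basis of `L²(ℤ_p^k × ℤ_p^{d-k})`. -/
def IsGaborONB2 {p k m : ℕ} [NeZero p] (g : ((Fin k → ZMod p) × (Fin m → ZMod p)) → ℂ)
    (A B : Finset ((Fin k → ZMod p) × (Fin m → ZMod p))) : Prop :=
  (∀ a ∈ A, ∀ b ∈ B, ∀ a' ∈ A, ∀ b' ∈ B,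
    innerC (gabor2 g a b) (gabor2 g a' b') = if a = a' ∧ b = b' then 1 else 0)
  ∧ (∀ f : ((Fin k → ZMod p) × (Fin m → ZMod p)) → ℂ,
      ∃ c : ((Fin k → ZMod p) × (Fin m → ZMod p)) → ((Fin k → ZMod p) × (Fin m → ZMod p)) → ℂ,
      f = fun x => ∑ a ∈ A, ∑ b ∈ B, c a b * gabor2 g a b x)

open ComplexConjugate

section Fourier

variable {p : ℕ} [Fact p.Prime] {n : ℕ}

lemma chi_eq_stdAddChar (t : ZMod p) : chi p t = ZMod.stdAddChar t := by
  rw [ZMod.stdAddChar_apply, ZMod.toCircle_apply, chi]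

lemma chi_zero : chi p 0 = 1 := by
  rw [chi_eq_stdAddChar, AddChar.map_zero_eq_one]

lemma chi_add (s t : ZMod p) : chi p (s + t) = chi p s * chi p t := by
  simp only [chi_eq_stdAddChar, AddChar.map_add_eq_mul]

lemma conj_chi (t : ZMod p) : conj (chi p t) = chi p (-t) := by
  rw [chi_eq_stdAddChar, chi_eq_stdAddChar, AddChar.map_neg_eq_conj]

lemma dotp_eq_dotProduct (x y : Fin n → ZMod p) : dotp x y = x ⬝ᵥ y := rfl

lemma sum_chi_dotp (x : Fin n → ZMod p) :
    ∑ m, chi p (dotp x m) = if x = 0 then (p : ℂ) ^ n else 0 := by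
  split_ifs with hx
  · simp [hx, dotp_eq_dotProduct, chi_zero, ZMod.card]
  · let ψ : AddChar (Fin n → ZMod p) ℂ :=
      { toFun := fun m => chi p (dotp x m)
        map_zero_eq_one' := by simp [dotp_eq_dotProduct, chi_zero]
        map_add_eq_mul' := fun a b => by simp [dotp_eq_dotProduct, dotProduct_add, chi_add] }
    obtain ⟨i, hi⟩ := Function.ne_iff.mp hx
    have hψ : ψ ≠ 0 := by
      rw [AddChar.ne_zero_iff]
      refine ⟨Pi.single i (x i)⁻¹, ?_⟩
      change chi p (dotp x _) ≠ 1
      rw [dotp_eq_dotProduct, dotProduct_single, mul_inv_cancel₀ hi, chi_eq_stdAddChar,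
        ← AddChar.map_zero_eq_one (ZMod.stdAddChar (N := p)), ZMod.injective_stdAddChar.ne_iff]
      exact one_ne_zero
    exact AddChar.sum_eq_zero_iff_ne_zero.mpr hψ

/-- Fourier inversion on `ℤ_p^n`. -/
lemma sum_sum_mul_chi_dotp (h : (Fin n → ZMod p) → ℂ) (y : Fin n → ZMod p) :
    ∑ m, (∑ x, h x * chi p (dotp x m)) * chi p (-(dotp y m)) = (p : ℂ) ^ n * h y := by
  have key : ∀ x, ∑ m, h x * chi p (dotp x m) * chi p (-(dotp y m))
      = if x = y then (p : ℂ) ^ n * h x else 0 := fun x => by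
    have : ∀ m, h x * chi p (dotp x m) * chi p (-(dotp y m)) = h x * chi p (dotp (x - y) m) :=
      fun m => by
        rw [mul_assoc, ← chi_add]
        rw [dotp_eq_dotProduct (x - y), sub_dotProduct, sub_eq_add_neg]
        rfl
    simp only [this, ← mul_sum, sum_chi_dotp, sub_eq_zero]
    split_ifs <;> ring
  simp_rw [sum_mul]
  rw [sum_comm]
  simp [key]

lemma eq_of_sum_mul_chi_dotp_eq {h h' : (Fin n → ZMod p) → ℂ}
    (H : ∀ m, ∑ x, h x * chi p (dotp x m) = ∑ x, h' x * chi p (dotp x m)) : h = h' := by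
  funext y
  have hp : (p : ℂ) ^ n ≠ 0 := pow_ne_zero _ (Nat.cast_ne_zero.mpr (NeZero.ne p))
  apply mul_left_cancel₀ hp
  simp only [← sum_sum_mul_chi_dotp, H]

/-- The Fourier transform of `h` is a multiple of the point mass at `0` iff `h` is constant. -/
lemma sum_mul_chi_dotp_eq_ite_iff (h : (Fin n → ZMod p) → ℂ) (c : ℂ) :
    (∀ m, ∑ x, h x * chi p (dotp x m) = if m = 0 then c * (p : ℂ) ^ n else 0) ↔ ∀ x, h x = c := by
  have hc : ∀ m : Fin n → ZMod p, ∑ x, c * chi p (dotp x m) =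
      if m = 0 then c * (p : ℂ) ^ n else 0 := fun m => by
    simp only [← mul_sum, dotp_eq_dotProduct, dotProduct_comm _ m]
    simp only [← dotp_eq_dotProduct, sum_chi_dotp, mul_ite, mul_zero]
  constructor
  · intro H
    exact congrFun (eq_of_sum_mul_chi_dotp_eq (h' := fun _ => c) fun m => (H m).trans (hc m).symm)
  · intro H m
    simp only [H, hc]

/-- The Fourier transform of `r` is constant iff `r` is a multiple of the point mass at `0`. -/
lemma sum_mul_chi_dotp_eq_iff (r : (Fin n → ZMod p) → ℂ) (c : ℂ) :
    (∀ m, ∑ x, r x * chi p (dotp x m) = c) ↔ ∀ x, r x = if x = 0 then c else 0 := by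
  have hc : ∀ m : Fin n → ZMod p, ∑ x, (if x = 0 then c else 0) * chi p (dotp x m) = c := fun m => by
    simp [dotp_eq_dotProduct, chi_zero]
  constructor
  · intro H
    exact congrFun (eq_of_sum_mul_chi_dotp_eq fun m => (H m).trans (hc m).symm)
  · intro H m
    simp only [H, hc]

/-- The autocorrelation of a function on `ℤ_p^n`. -/
noncomputable def autocorr (u : (Fin n → ZMod p) → ℂ) (a : Fin n → ZMod p) : ℂ :=
  ∑ x, u x * conj (u (x + a))

lemma autocorr_zero (u : (Fin n → ZMod p) → ℂ) :
    autocorr u 0 = ((∑ x, ‖u x‖ ^ 2 : ℝ) : ℂ) := by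
  simp [autocorr, Complex.mul_conj']

lemma sum_shift_mul_conj_shift (u : (Fin n → ZMod p) → ℂ) (a a' : Fin n → ZMod p) :
    ∑ x, u (x - a) * conj (u (x - a')) = autocorr u (a - a') := by
  rw [autocorr, ← Equiv.sum_comp (Equiv.subRight a) fun x => u x * conj (u (x + (a - a')))]
  refine sum_congr rfl fun x _ => ?_
  simp

/-- Wiener-Khinchin: the power spectrum is the Fourier transform of the autocorrelation. -/
lemma sum_autocorr_mul_chi_dotp (u : (Fin n → ZMod p) → ℂ) (m : Fin n → ZMod p) :
    ∑ a, autocorr u a * chi p (dotp a m) =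
      ((‖∑ x, u x * chi p (-(dotp x m))‖ ^ 2 : ℝ) : ℂ) := by
  push_cast
  rw [← Complex.mul_conj', map_sum, sum_mul_sum]
  simp_rw [autocorr, sum_mul]
  rw [sum_comm]
  refine sum_congr rfl fun x _ => ?_
  rw [← Equiv.sum_comp (Equiv.addLeft x) fun y =>
    u x * chi p (-(dotp x m)) * conj (u y * chi p (-(dotp y m)))]
  refine sum_congr rfl fun a _ => ?_
  have : chi p (dotp a m) = chi p (-(dotp x m)) * chi p (dotp (x + a) m) := by
    rw [← chi_add]
    simp [dotp_eq_dotProduct, add_dotProduct]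
  rw [Equiv.coe_addLeft, map_mul, conj_chi, neg_neg, this]
  ring

/-- The modulus of the Fourier transform is constant iff the autocorrelation vanishes off `0`. -/
lemma exists_norm_sum_eq_iff_autocorr (u : (Fin n → ZMod p) → ℂ) :
    (∃ C : ℝ, ∀ m, ‖∑ x, u x * chi p (-(dotp x m))‖ = C) ↔ ∀ a, a ≠ 0 → autocorr u a = 0 := by
  constructor
  · rintro ⟨C, hC⟩ a ha
    have := (sum_mul_chi_dotp_eq_iff (autocorr u) ((C ^ 2 : ℝ) : ℂ)).mp
      (fun m => by rw [sum_autocorr_mul_chi_dotp, hC]) a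
    rwa [if_neg ha] at this
  · intro H
    have := (sum_mul_chi_dotp_eq_iff (autocorr u) (autocorr u 0)).mpr fun a => by
      split_ifs with ha
      · rw [ha]
      · exact H a ha
    refine ⟨‖∑ x, u x * chi p (-(dotp x 0))‖, fun m => ?_⟩
    have h2 := (this m).trans (this 0).symm
    rw [sum_autocorr_mul_chi_dotp, sum_autocorr_mul_chi_dotp, Complex.ofReal_inj] at h2
    exact (pow_left_inj₀ (norm_nonneg _) (norm_nonneg _) two_ne_zero).mp h2

end Fourier

section Gabor

variable {p : ℕ} [Fact p.Prime] {k n : ℕ}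

lemma innerC_gabor2 (g : (Fin k → ZMod p) × (Fin n → ZMod p) → ℂ)
    (a a' : Fin k → ZMod p) (b b' : Fin n → ZMod p) :
    innerC (gabor2 g (a, 0) (0, b)) (gabor2 g (a', 0) (0, b')) =
      ∑ x₂, autocorr (fun x₁ => g (x₁, x₂)) (a - a') * chi p (dotp x₂ (b - b')) := by
  rw [innerC, Fintype.sum_prod_type_right]
  refine sum_congr rfl fun x₂ _ => ?_
  rw [← sum_shift_mul_conj_shift, sum_mul]
  refine sum_congr rfl fun x₁ _ => ?_
  have : chi p (dotp x₂ (b - b')) = chi p (dotp x₂ b) * conj (chi p (dotp x₂ b')) := by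
    rw [conj_chi, ← chi_add]
    rw [dotp_eq_dotProduct _ (b - b'), dotProduct_sub, sub_eq_add_neg]
    rfl
  have h0 : dotp x₁ 0 = 0 := dotProduct_zero x₁
  simp only [gabor2, dotp2, Prod.mk_sub_mk, sub_zero, map_mul, this, h0, zero_add]
  ring

/-- Orthonormality of the Gabor system in terms of autocorrelations of the slices of `g`. -/
lemma forall_innerC_gabor2_eq_ite_iff (g : (Fin k → ZMod p) × (Fin n → ZMod p) → ℂ) :
    (∀ a b a' b', innerC (gabor2 g (a, 0) (0, b)) (gabor2 g (a', 0) (0, b')) =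
        if a = a' ∧ b = b' then 1 else 0) ↔
      ∀ a x₂, autocorr (fun x₁ => g (x₁, x₂)) a = if a = 0 then ((p : ℂ) ^ n)⁻¹ else 0 := by
  have hp : (p : ℂ) ^ n ≠ 0 := pow_ne_zero _ (Nat.cast_ne_zero.mpr (NeZero.ne p))
  have key : ∀ (a : Fin k → ZMod p) (m : Fin n → ZMod p),
      (if m = 0 then (if a = 0 then ((p : ℂ) ^ n)⁻¹ else 0) * (p : ℂ) ^ n else 0) =
        if a = 0 ∧ m = 0 then 1 else 0 := fun a m => by
    by_cases ha : a = 0 <;> by_cases hm : m = 0 <;> simp [ha, hm, hp]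
  simp_rw [innerC_gabor2, ← sum_mul_chi_dotp_eq_ite_iff, key]
  constructor
  · intro H a m
    simpa using H a m 0 0
  · intro H a b a' b'
    simpa only [sub_eq_zero] using H (a - a') (b - b')

/-- An orthonormal family in `L²(V)` indexed by `V` spans. -/
lemma eq_sum_innerC_mul_of_orthonormal {V : Type*} [Fintype V] [DecidableEq V] (e : V → V → ℂ)
    (he : ∀ i j, innerC (e i) (e j) = if i = j then 1 else 0) (f : V → ℂ) (x : V) :
    f x = ∑ i, innerC f (e i) * e i x := by
  have h1 : Matrix.of e * (Matrix.of e).conjTranspose = 1 := by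
    ext i j
    simpa [Matrix.mul_apply, Matrix.one_apply, innerC] using he i j
  have h2 := mul_eq_one_comm.mp h1
  have h3 : ∀ y, ∑ i, conj (e i y) * e i x = if y = x then 1 else 0 := fun y => by
    simpa [Matrix.mul_apply, Matrix.one_apply] using congrFun (congrFun h2 y) x
  simp_rw [innerC, sum_mul]
  rw [sum_comm]
  simp_rw [mul_assoc, ← mul_sum, h3]
  simp

lemma isGaborONB2_iff_autocorr (g : (Fin k → ZMod p) × (Fin n → ZMod p) → ℂ) :
    IsGaborONB2 g (univ.image fun a : Fin k → ZMod p => (a, (0 : Fin n → ZMod p)))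
        (univ.image fun b : Fin n → ZMod p => ((0 : Fin k → ZMod p), b)) ↔
      ∀ a x₂, autocorr (fun x₁ => g (x₁, x₂)) a = if a = 0 then ((p : ℂ) ^ n)⁻¹ else 0 := by
  rw [← forall_innerC_gabor2_eq_ite_iff, IsGaborONB2]
  constructor
  · rintro ⟨H, -⟩ a b a' b'
    simpa using H (a, 0) (by simp) (0, b) (by simp) (a', 0) (by simp) (0, b') (by simp)
  · intro H
    refine ⟨?_, fun f => ⟨fun a b => innerC f (gabor2 g a b), ?_⟩⟩
    · simp only [mem_image, mem_univ, true_and]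
      rintro _ ⟨a, rfl⟩ _ ⟨b, rfl⟩ _ ⟨a', rfl⟩ _ ⟨b', rfl⟩
      simpa using H a b a' b'
    · funext x
      rw [eq_sum_innerC_mul_of_orthonormal (fun i => gabor2 g (i.1, 0) (0, i.2))
        (fun i j => by simp only [H, Prod.ext_iff]) f x, Fintype.sum_prod_type,
        sum_image (by intro a _ b _ h; simpa using h)]
      refine sum_congr rfl fun a _ => ?_
      rw [sum_image (by intro a _ b _ h; simpa using h)]

end Gabor

/-- Writing `ℤ_p^d = ℤ_p^k × ℤ_p^{d-k}` with `1 ≤ k < d`,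
`A = ℤ_p^k × {0}` and `B = {0} × ℤ_p^{d-k}`, the system `𝒢(g, A, B)` is an orthonormal
basis of `L²(ℤ_p^d)` iff (a) for each `x₂` the function
`m ↦ |Σ_{x₁} g(x₁,x₂) χ(-x₁·m)|` is constant, and (b) `x₂ ↦ Σ_{x₁} |g(x₁,x₂)|²`
is constant. -/
theorem gabor_onb_iff_of_subspace_translations
    (p : ℕ) [Fact p.Prime] (d k : ℕ) (hk : 1 ≤ k) (hkd : k < d)
    (g : ((Fin k → ZMod p) × (Fin (d - k) → ZMod p)) → ℂ) (hg : ∑ x, ‖g x‖ ^ 2 = 1) :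
    IsGaborONB2 g
        (Finset.univ.image (fun a : Fin k → ZMod p => (a, (0 : Fin (d - k) → ZMod p))))
        (Finset.univ.image (fun b : Fin (d - k) → ZMod p => ((0 : Fin k → ZMod p), b))) ↔
      ((∀ x₂ : Fin (d - k) → ZMod p, ∃ C : ℝ, ∀ m : Fin k → ZMod p,
          ‖∑ x₁ : Fin k → ZMod p, g (x₁, x₂) * chi p (-(dotp x₁ m))‖ = C)
        ∧ (∃ C : ℝ, ∀ x₂ : Fin (d - k) → ZMod p,
          ∑ x₁ : Fin k → ZMod p, ‖g (x₁, x₂)‖ ^ 2 = C)) := by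
  rw [isGaborONB2_iff_autocorr]
  simp_rw [fun x₂ => exists_norm_sum_eq_iff_autocorr fun x₁ => g (x₁, x₂)]
  constructor
  · intro H
    refine ⟨fun x₂ a ha => by rw [H, if_neg ha], ((p : ℝ) ^ (d - k))⁻¹, fun x₂ => ?_⟩
    have := H 0 x₂
    rw [autocorr_zero, if_pos rfl] at this
    apply Complex.ofReal_injective
    rw [this]
    push_cast
    rfl
  · rintro ⟨Ha, C, hC⟩ a x₂
    split_ifs with ha
    · have hC' : (p : ℝ) ^ (d - k) * C = 1 := by
        rw [Fintype.sum_prod_type_right] at hg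
        simpa [hC, ZMod.card] using hg
      rw [ha, autocorr_zero, hC, eq_inv_of_mul_eq_one_right hC']
      push_cast
      rfl
    · exact Ha x₂ a ha
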